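/- arXiv:1812.08688 — 7 statements merged into one kernel-verified Lean document; each statement's English description precedes it below -/
import Mathlib

section
/- For every integer n ≥ 1 one has √(2n − √(2n)) ≤ ρ_n < √(2n). -/
/-- If `r > 0`, then `s = (r + √(r² + 4)) / 2` is positive and `s² = r s + 1`. -/
lemma rho_step {r s : ℝ} (hr : 0 < r) (hs : s = (r + Real.sqrt (r ^ 2 + 4)) / 2) :
    0 < s ∧ s ^ 2 = r * s + 1 := by
  have hsq : Real.sqrt (r ^ 2 + 4) ^ 2 = r ^ 2 + 4 := Real.sq_sqrt (by positivity)
  subst hs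
  exact ⟨by positivity, by linear_combination hsq / 4⟩

/-- If `s² = r s + 1`, then `a = s²` satisfies `a² + 1 = a (r² + 2)`. -/
lemma rho_step_sq {r s : ℝ} (h : s ^ 2 = r * s + 1) :
    (s ^ 2) ^ 2 + 1 = s ^ 2 * (r ^ 2 + 2) := by
  linear_combination (s ^ 2 - 1 + r * s) * h

/-- The bound `x - √x` propagates along `a² + 1 = a (b + 2)` when `x` grows by `2`. -/
lemma sub_sqrt_le_of_sq_add_one_eq {x a b : ℝ} (hx : 2 ≤ x) (ha : 1 ≤ a)
    (hab : a ^ 2 + 1 = a * (b + 2)) (hb : x - Real.sqrt x ≤ b) :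
    x + 2 - Real.sqrt (x + 2) ≤ a := by
  have hu : Real.sqrt x ^ 2 = x := Real.sq_sqrt (by linarith)
  have hv : Real.sqrt (x + 2) ^ 2 = x + 2 := Real.sq_sqrt (by linarith)
  have hu0 := Real.sqrt_nonneg x
  have huv : Real.sqrt x < Real.sqrt (x + 2) := Real.sqrt_lt_sqrt (by linarith) (by linarith)
  have hv2 : 2 ≤ Real.sqrt (x + 2) := Real.le_sqrt_of_sq_le (by linarith)
  set u := Real.sqrt x
  set v := Real.sqrt (x + 2)
  by_contra! hlt
  obtain ⟨t, ht⟩ : ∃ t, t = x + 2 - v := ⟨_, rfl⟩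
  rw [← ht] at hlt
  have htv : v ≤ t := by nlinarith
  have hdiff : (v - u) * (v + u) = 2 := by linear_combination hv - hu
  have h1 : 1 ≤ t * (v - u) := by
    nlinarith [mul_le_mul_of_nonneg_left (show v + u ≤ 2 * t by linarith) (sub_pos.2 huv).le]
  have h2 : a * (t + (v - u)) ≤ a ^ 2 + 1 := by
    rw [hab]
    exact mul_le_mul_of_nonneg_left (by linarith) (by linarith)
  have h3 : a * (t ^ 2 + 1) ≤ t * (a ^ 2 + 1) := by
    nlinarith [mul_le_mul_of_nonneg_left h2 (show 0 ≤ t by linarith),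
      mul_le_mul_of_nonneg_left h1 (show 0 ≤ a by linarith)]
  nlinarith [mul_pos (sub_pos.2 hlt) (show 0 < a * t - 1 by nlinarith)]

/-- Let `ρ₁ = 1` and `ρ_{n+1} = (ρ_n + √(ρ_n² + 4))/2` for `n ≥ 1`.
Then for every integer `n ≥ 1` one has `√(2n − √(2n)) ≤ ρ_n < √(2n)`. -/
theorem rho_bounds (ρ : ℕ → ℝ) (h1 : ρ 1 = 1)
    (hrec : ∀ n, 1 ≤ n → ρ (n + 1) = (ρ n + Real.sqrt ((ρ n) ^ 2 + 4)) / 2) :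
    ∀ n : ℕ, 1 ≤ n →
      Real.sqrt (2 * (n : ℝ) - Real.sqrt (2 * (n : ℝ))) ≤ ρ n ∧
        ρ n < Real.sqrt (2 * (n : ℝ)) := by
  have key : ∀ n : ℕ, 1 ≤ n → 0 < ρ n ∧ ρ n ^ 2 < 2 * (n : ℝ) ∧
      2 * (n : ℝ) - Real.sqrt (2 * (n : ℝ)) ≤ ρ n ^ 2 := by
    intro n hn
    induction n, hn using Nat.le_induction with
    | base =>
      have h : (1 : ℝ) ≤ Real.sqrt 2 := Real.one_le_sqrt.2 (by norm_num)
      rw [h1]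
      norm_num
      linarith
    | succ n hn ih =>
      obtain ⟨hpos, hup, hlow⟩ := ih
      obtain ⟨hspos, hs⟩ := rho_step hpos (hrec n hn)
      have hsq := rho_step_sq hs
      have hn' : (1 : ℝ) ≤ n := by exact_mod_cast hn
      have hcast : 2 * ((n + 1 : ℕ) : ℝ) = 2 * (n : ℝ) + 2 := by push_cast; ring
      have hone : 1 ≤ ρ (n + 1) ^ 2 := by nlinarith [mul_pos hpos hspos]
      rw [hcast]
      exact ⟨hspos, by nlinarith,
        sub_sqrt_le_of_sq_add_one_eq (by linarith) hone hsq hlow⟩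
  intro n hn
  obtain ⟨hpos, hup, hlow⟩ := key n hn
  exact ⟨Real.sqrt_le_iff.2 ⟨hpos.le, hlow⟩, Real.lt_sqrt_of_sq_lt hup⟩
end

section
/- For every integer n ≥ 1, setting m = 2n, one has √(m − √m) + √((m − √m)² + 4) ≥ 2√(m + 2 − √(m+2)). -/
/-- A sufficient lower bound, valid for all `a ≥ 2`. -/
theorem two_mul_sqrt_add_two_le {a : ℝ} (ha : 2 ≤ a) :
    2 * √(a + 2) ≤ √a + √(a ^ 2 + 4) := by
  have hx := Real.sq_sqrt (show 0 ≤ a by linarith)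
  have hy := Real.sq_sqrt (show 0 ≤ a ^ 2 + 4 by positivity)
  have hz := Real.sq_sqrt (show 0 ≤ a + 2 by linarith)
  have hxy : 4 ≤ √a * √(a ^ 2 + 4) := by
    rw [← Real.sqrt_mul (by linarith)]
    apply Real.le_sqrt_of_sq_le
    nlinarith [mul_nonneg (sub_nonneg.2 ha) (sq_nonneg a)]
  refine (pow_le_pow_iff_left₀ (by positivity) (by positivity) two_ne_zero).1 ?_
  nlinarith [sq_nonneg (a - 3 / 2)]

/-- The case `m = 2`, where the inequality is nearly an equality. -/
theorem two_mul_sqrt_two_le :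
    2 * √2 ≤ √(2 - √2) + √((2 - √2) ^ 2 + 4) := by
  have h2 := Real.sq_sqrt (show (0 : ℝ) ≤ 2 by norm_num)
  have hs : √2 ≤ 1.41422 := Real.sqrt_le_iff.2 (by norm_num)
  have h₁ : 0.765 ≤ √(2 - √2) := Real.le_sqrt_of_sq_le (by linarith)
  have h₂ : 2.083 ≤ √((2 - √2) ^ 2 + 4) := Real.le_sqrt_of_sq_le (by nlinarith)
  linarith

/-- For every integer `n ≥ 1`, setting `m = 2n`, one has
`√(m − √m) + √((m − √m)² + 4) ≥ 2√(m + 2 − √(m+2))`. -/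
theorem sqrt_sum_ge (n : ℕ) (hn : 1 ≤ n) :
    Real.sqrt (2 * (n : ℝ) - Real.sqrt (2 * (n : ℝ))) +
      Real.sqrt ((2 * (n : ℝ) - Real.sqrt (2 * (n : ℝ))) ^ 2 + 4) ≥
      2 * Real.sqrt (2 * (n : ℝ) + 2 - Real.sqrt (2 * (n : ℝ) + 2)) := by
  rcases hn.eq_or_lt with rfl | hn
  · have h4 : √(4 : ℝ) = 2 := by
      rw [Real.sqrt_eq_iff_mul_self_eq] <;> norm_num
    have h : (2 * ((1 : ℕ) : ℝ) + 2) = 4 := by norm_num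
    rw [h, h4, Nat.cast_one, mul_one, show (4 : ℝ) - 2 = 2 by norm_num]
    exact two_mul_sqrt_two_le
  · have hn' : (2 : ℝ) ≤ n := by exact_mod_cast hn
    have hs : 2 ≤ √(2 * (n : ℝ)) := Real.le_sqrt_of_sq_le (by linarith)
    have hsq := Real.sq_sqrt (show 0 ≤ 2 * (n : ℝ) by linarith)
    have hmono : √(2 * (n : ℝ)) ≤ √(2 * (n : ℝ) + 2) := Real.sqrt_le_sqrt (by linarith)
    refine le_trans ?_ (two_mul_sqrt_add_two_le (by nlinarith))
    gcongr
    linarith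
end

section
/- The sequence (ρ_n/√n)_{n≥1} converges to √2 as n → ∞. -/
/-- The larger root `y` of `y² = x y + 1` satisfies `y² - x² = 2 - 1 / y²`. -/
theorem sq_sub_sq_eq_of_sq_eq_mul_add_one {x y : ℝ} (hy : y ≠ 0) (h : y ^ 2 = x * y + 1) :
    y ^ 2 - x ^ 2 = 2 - (y ^ 2)⁻¹ := by
  have hx : x = y - y⁻¹ := by
    field_simp
    linarith
  rw [hx]
  field_simp
  ring

/-- Positivity and the defining quadratic equation for `y = (x + √(x² + 4)) / 2`. -/
theorem half_add_sqrt_sq_add_four {x : ℝ} (hx : 0 < x) :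
    0 < (x + Real.sqrt (x ^ 2 + 4)) / 2 ∧
      ((x + Real.sqrt (x ^ 2 + 4)) / 2) ^ 2 = x * ((x + Real.sqrt (x ^ 2 + 4)) / 2) + 1 := by
  refine ⟨by positivity, ?_⟩
  have h := Real.sq_sqrt (show (0 : ℝ) ≤ x ^ 2 + 4 by positivity)
  linear_combination h / 4

/-- Let `ρ₁ = 1` and `ρ_{n+1} = (ρ_n + √(ρ_n² + 4))/2` for `n ≥ 1`.
Then the sequence `(ρ_n/√n)` converges to `√2` as `n → ∞`. -/
theorem rho_div_sqrt_tendsto (ρ : ℕ → ℝ) (h1 : ρ 1 = 1)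
    (hrec : ∀ n, 1 ≤ n → ρ (n + 1) = (ρ n + Real.sqrt ((ρ n) ^ 2 + 4)) / 2) :
    Filter.Tendsto (fun n : ℕ => ρ n / Real.sqrt n) Filter.atTop
      (nhds (Real.sqrt 2)) := by
  have step (n : ℕ) (hn : 1 ≤ n) (hpos : 0 < ρ n) :
      0 < ρ (n + 1) ∧ ρ (n + 1) ^ 2 = ρ n * ρ (n + 1) + 1 := by
    rw [hrec n hn]
    exact half_add_sqrt_sq_add_four hpos
  have bound (n : ℕ) (hn : 1 ≤ n) : 0 < ρ n ∧ (n : ℝ) ≤ ρ n ^ 2 := by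
    induction n, hn using Nat.le_induction with
    | base => simp [h1]
    | succ n hn ih =>
      obtain ⟨hpos, heq⟩ := step n hn ih.1
      have hdiff := sq_sub_sq_eq_of_sq_eq_mul_add_one hpos.ne' heq
      have hinv : (ρ (n + 1) ^ 2)⁻¹ ≤ 1 :=
        inv_le_one_of_one_le₀ (by nlinarith [mul_pos ih.1 hpos])
      refine ⟨hpos, ?_⟩
      push_cast
      linarith [ih.2]
  have hsq : Filter.Tendsto (fun n => ρ n ^ 2) Filter.atTop Filter.atTop :=
    Filter.tendsto_atTop_mono' _
      ((Filter.eventually_ge_atTop 1).mono fun n hn => (bound n hn).2)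
      tendsto_natCast_atTop_atTop
  have hdiff : Filter.Tendsto (fun n => ρ (n + 1) ^ 2 - ρ n ^ 2) Filter.atTop (nhds 2) := by
    have hlim : Filter.Tendsto (fun n => 2 - (ρ (n + 1) ^ 2)⁻¹) Filter.atTop (nhds (2 - 0)) :=
      tendsto_const_nhds.sub
        (tendsto_inv_atTop_zero.comp (hsq.comp (Filter.tendsto_add_atTop_nat 1)))
    rw [sub_zero] at hlim
    refine hlim.congr' ((Filter.eventually_ge_atTop 1).mono fun n hn => ?_)
    obtain ⟨hpos, heq⟩ := step n hn (bound n hn).1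
    exact (sq_sub_sq_eq_of_sq_eq_mul_add_one hpos.ne' heq).symm
  have hmean : Filter.Tendsto (fun n : ℕ => ρ n ^ 2 / n) Filter.atTop (nhds 2) := by
    have hsum := hdiff.cesaro.add (tendsto_const_div_atTop_nhds_zero_nat (ρ 0 ^ 2))
    rw [add_zero] at hsum
    refine hsum.congr fun n => ?_
    rw [Finset.sum_range_sub (fun i => ρ i ^ 2)]
    ring
  refine hmean.sqrt.congr' ((Filter.eventually_ge_atTop 1).mono fun n hn => ?_)
  rw [Real.sqrt_div (sq_nonneg _), Real.sqrt_sq (bound n hn).1.le]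
end

section
/- For every integer n ≥ 1 one has (2/√n − 1/√(n+1)) ρ_n < √((ρ_n² + 4)/(n+1)); consequently the sequence (ρ_n/√n)_{n≥1} is strictly increasing. -/
/-- If `ρ₁ = 1` and `ρ_{n+1} = (ρ_n + √(ρ_n² + 4))/2`, then `ρ_n > 0` and `ρ_n² ≤ 2n - 1`. -/
lemma pos_and_sq_le_of_sqrt_recurrence (ρ : ℕ → ℝ) (h1 : ρ 1 = 1)
    (hrec : ∀ n, 1 ≤ n → ρ (n + 1) = (ρ n + Real.sqrt ((ρ n) ^ 2 + 4)) / 2)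
    (n : ℕ) (hn : 1 ≤ n) : 0 < ρ n ∧ (ρ n) ^ 2 ≤ 2 * n - 1 := by
  induction n, hn using Nat.le_induction with
  | base => norm_num [h1]
  | succ n hn ih =>
    obtain ⟨hpos, hle⟩ := ih
    have hR : Real.sqrt ((ρ n) ^ 2 + 4) ^ 2 = (ρ n) ^ 2 + 4 := Real.sq_sqrt (by positivity)
    have hR0 : 0 ≤ Real.sqrt ((ρ n) ^ 2 + 4) := Real.sqrt_nonneg _
    rw [hrec n hn]
    refine ⟨by positivity, ?_⟩
    push_cast
    nlinarith [sq_nonneg (Real.sqrt ((ρ n) ^ 2 + 4) - ρ n)]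

/-- The algebraic core: if `t² = s² + 1` and `x² ≤ 2s² - 1`, then `(2t - s)x < s√(x² + 4)`. -/
lemma two_mul_sub_mul_lt_mul_sqrt {s t x : ℝ} (hs : 0 < s) (ht : 0 < t)
    (hst : t ^ 2 = s ^ 2 + 1) (hx : x ^ 2 ≤ 2 * s ^ 2 - 1) :
    (2 * t - s) * x < s * Real.sqrt (x ^ 2 + 4) := by
  have hlt : s < t := by nlinarith
  have hcube : (s ^ 2 - 1) * t < s ^ 3 := by
    refine lt_of_mul_lt_mul_right ?_ ht.le
    calc (s ^ 2 - 1) * t * t = s ^ 3 * s - 1 := by linear_combination (s ^ 2 - 1) * hst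
      _ < s ^ 3 * s := by linarith
      _ ≤ s ^ 3 * t := by gcongr
  have hbound : x ^ 2 * t < s ^ 2 * (t + s) := by
    nlinarith [mul_le_mul_of_nonneg_right hx ht.le]
  have hprod : x ^ 2 * t * (t - s) < s ^ 2 := by
    calc x ^ 2 * t * (t - s) < s ^ 2 * (t + s) * (t - s) :=
          mul_lt_mul_of_pos_right hbound (sub_pos.2 hlt)
      _ = s ^ 2 := by linear_combination s ^ 2 * hst
  refine lt_of_pow_lt_pow_left₀ 2 (by positivity) ?_
  rw [mul_pow s, Real.sq_sqrt (by positivity)]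
  linarith

/-- Let `ρ₁ = 1` and `ρ_{n+1} = (ρ_n + √(ρ_n² + 4))/2` for `n ≥ 1`.
Then for every `n ≥ 1`, `(2/√n − 1/√(n+1)) ρ_n < √((ρ_n² + 4)/(n+1))`; consequently
the sequence `(ρ_n/√n)_{n ≥ 1}` is strictly increasing. -/
theorem rho_div_sqrt_strictMono (ρ : ℕ → ℝ) (h1 : ρ 1 = 1)
    (hrec : ∀ n, 1 ≤ n → ρ (n + 1) = (ρ n + Real.sqrt ((ρ n) ^ 2 + 4)) / 2) :
    (∀ n : ℕ, 1 ≤ n →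
        (2 / Real.sqrt n - 1 / Real.sqrt ((n : ℝ) + 1)) * ρ n <
          Real.sqrt (((ρ n) ^ 2 + 4) / ((n : ℝ) + 1))) ∧
      ∀ n m : ℕ, 1 ≤ n → n < m → ρ n / Real.sqrt n < ρ m / Real.sqrt m := by
  have hsqrt : ∀ n : ℕ, 1 ≤ n → 0 < Real.sqrt n := fun n hn =>
    Real.sqrt_pos.2 (by exact_mod_cast hn)
  have hsqrt' : ∀ n : ℕ, 0 < Real.sqrt ((n : ℝ) + 1) := fun n => Real.sqrt_pos.2 (by positivity)
  have key : ∀ n : ℕ, 1 ≤ n →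
      (2 / Real.sqrt n - 1 / Real.sqrt ((n : ℝ) + 1)) * ρ n <
        Real.sqrt (((ρ n) ^ 2 + 4) / ((n : ℝ) + 1)) := by
    intro n hn
    have hs := hsqrt n hn
    have ht := hsqrt' n
    have hs2 : Real.sqrt n ^ 2 = n := Real.sq_sqrt (by positivity)
    have ht2 : Real.sqrt ((n : ℝ) + 1) ^ 2 = n + 1 := Real.sq_sqrt (by positivity)
    have hx := (pos_and_sq_le_of_sqrt_recurrence ρ h1 hrec n hn).2
    have hmain := two_mul_sub_mul_lt_mul_sqrt (x := ρ n) hs ht (by rw [hs2, ht2])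
      (by rw [hs2]; exact hx)
    rw [Real.sqrt_div (by positivity), div_sub_div _ _ hs.ne' ht.ne', div_mul_eq_mul_div,
      div_lt_div_iff₀ (by positivity) ht]
    nlinarith [mul_lt_mul_of_pos_right hmain ht]
  have step : ∀ n : ℕ, 1 ≤ n →
      ρ n / Real.sqrt n < ρ (n + 1) / Real.sqrt ((n + 1 : ℕ) : ℝ) := by
    intro n hn
    have h := key n hn
    rw [Real.sqrt_div (by positivity)] at h
    rw [hrec n hn]
    push_cast
    have e : (ρ n + Real.sqrt ((ρ n) ^ 2 + 4)) / 2 / Real.sqrt ((n : ℝ) + 1) - ρ n / Real.sqrt n =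
        (Real.sqrt ((ρ n) ^ 2 + 4) / Real.sqrt ((n : ℝ) + 1) -
          (2 / Real.sqrt n - 1 / Real.sqrt ((n : ℝ) + 1)) * ρ n) / 2 := by ring
    linarith
  refine ⟨key, fun n m hn hnm => ?_⟩
  induction m, hnm using Nat.le_induction with
  | base => exact step n hn
  | succ m hm ih => exact ih.trans (step m (by omega))
end

section
/- Let P, Q be real polynomials whose sets of real roots are exactly {p₁,…,p_m} and {q₁,…,q_s} respectively (m, s ≥ 1). Assume these two sets are disjoint and that Q(p_j) > 0 for every j = 1,…,m. Let r₁ < r₂ < ⋯ < r_{m+s} be all these real roots arranged in increasing order. If for some index j the numbers r_j and r_{j+1} are roots of different polynomials (i.e. one is a root of P and the other a root of Q), then the polynomial P(t)² − Q(t) has at least one real root in the open interval (r_j, r_{j+1}). -/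
theorem Polynomial.eval_sq_sub_neg {P Q : Polynomial ℝ} {x : ℝ} (hP : P.eval x = 0)
    (hQ : 0 < Q.eval x) : (P ^ 2 - Q).eval x < 0 := by
  simpa [hP] using hQ

theorem Polynomial.eval_sq_sub_pos {P Q : Polynomial ℝ} {x : ℝ} (hP : P.eval x ≠ 0)
    (hQ : Q.eval x = 0) : 0 < (P ^ 2 - Q).eval x := by
  simpa [hQ] using pow_pos (abs_pos.mpr hP) 2


/-- Let `P, Q` be real polynomials whose sets of real roots are exactly
`{p₁,…,p_m}` and `{q₁,…,q_s}` respectively (`m, s ≥ 1`), the two sets being disjoint and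
`Q(p_j) > 0` for every `j`. Let `r₁ < ⋯ < r_{m+s}` be all these roots in increasing order.
If for some `j` the numbers `r_j` and `r_{j+1}` are roots of different polynomials, then
`P² − Q` has at least one real root in the open interval `(r_j, r_{j+1})`. -/
theorem root_between (P Q : Polynomial ℝ) (m s : ℕ) (hm : 1 ≤ m) (hs : 1 ≤ s)
    (p : Fin m → ℝ) (q : Fin s → ℝ)
    (hpinj : Function.Injective p) (hqinj : Function.Injective q)
    (hProots : {x : ℝ | P.eval x = 0} = Set.range p)
    (hQroots : {x : ℝ | Q.eval x = 0} = Set.range q)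
    (hdisj : Disjoint (Set.range p) (Set.range q))
    (hQpos : ∀ j, 0 < Q.eval (p j))
    (r : Fin (m + s) → ℝ) (hmono : StrictMono r)
    (hrange : Set.range r = Set.range p ∪ Set.range q)
    (j : ℕ) (hj : j + 1 < m + s)
    (hdiff :
      (P.eval (r ⟨j, Nat.lt_of_succ_lt hj⟩) = 0 ∧ Q.eval (r ⟨j + 1, hj⟩) = 0) ∨
        (Q.eval (r ⟨j, Nat.lt_of_succ_lt hj⟩) = 0 ∧ P.eval (r ⟨j + 1, hj⟩) = 0)) :
    ∃ x ∈ Set.Ioo (r ⟨j, Nat.lt_of_succ_lt hj⟩) (r ⟨j + 1, hj⟩),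
      (P ^ 2 - Q).eval x = 0 := by
  have hQpos' : ∀ x, P.eval x = 0 → 0 < Q.eval x := fun x hx => by
    obtain ⟨i, rfl⟩ := hProots.subset hx
    exact hQpos i
  have hPne : ∀ x, Q.eval x = 0 → P.eval x ≠ 0 := fun x hQ hP => (hQpos' x hP).ne' hQ
  have hle := (hmono (Fin.mk_lt_mk.mpr j.lt_succ_self :
    (⟨j, Nat.lt_of_succ_lt hj⟩ : Fin (m + s)) < ⟨j + 1, hj⟩)).le
  rcases hdiff with ⟨hP, hQ⟩ | ⟨hQ, hP⟩
  · exact intermediate_value_Ioo hle (P ^ 2 - Q).continuous.continuousOn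
      ⟨Polynomial.eval_sq_sub_neg hP (hQpos' _ hP), Polynomial.eval_sq_sub_pos (hPne _ hQ) hQ⟩
  · exact intermediate_value_Ioo' hle (P ^ 2 - Q).continuous.continuousOn
      ⟨Polynomial.eval_sq_sub_neg hP (hQpos' _ hP), Polynomial.eval_sq_sub_pos (hPne _ hQ) hQ⟩
end

section
/- The operators S₂ = s₁ + s₂ and S₃ = s₁ + s₂ + s₃ satisfy the polynomial identities 3S₂² − S₂⁴ = I and 7S₃² − 13S₃⁴ + 7S₃⁶ − S₃⁸ = I, where I is the identity operator on the monotone Fock space. -/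
/-- The index set of the discrete monotone Fock space: finite strictly increasing
sequences of positive integers (including the empty sequence). -/
abbrev MonIdx : Type := {l : List ℕ+ // l.Chain' (· < ·)}

/-- `l` is an increasing sequence all of whose entries exceed `n`. -/
def IsTail (n : ℕ) (l : List ℕ+) : Prop :=
  l.IsChain (· < ·) ∧ ∀ x ∈ l, n < (x : ℕ)

theorem isTail_cons_iff {n : ℕ} {i : ℕ+} {l : List ℕ+} :
    IsTail n (i :: l) ↔ n < (i : ℕ) ∧ IsTail i l := by
  unfold IsTail
  rw [List.isChain_iff_pairwise, List.isChain_iff_pairwise, List.pairwise_cons]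
  constructor
  · rintro ⟨⟨h1, h2⟩, h3⟩
    exact ⟨h3 i (by simp), h2, fun x hx => h1 x hx⟩
  · rintro ⟨h1, h2, h3⟩
    refine ⟨⟨fun x hx => h3 x hx, h2⟩, ?_⟩
    intro x hx
    rcases List.mem_cons.1 hx with rfl | hx
    · exact h1
    · exact h1.trans (h3 x hx)

theorem IsTail.mono {m n : ℕ} {l : List ℕ+} (h : IsTail n l) (hmn : m ≤ n) : IsTail m l :=
  ⟨h.1, fun x hx => hmn.trans_lt (h.2 x hx)⟩

theorem IsTail.succ_or_cons {n : ℕ} {l : List ℕ+} (h : IsTail n l) (i : ℕ+) (hi : (i : ℕ) = n + 1) :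
    IsTail i l ∨ ∃ t, IsTail i t ∧ l = i :: t := by
  cases l with
  | nil => exact Or.inl ⟨h.1, by simp⟩
  | cons j t =>
    obtain ⟨h1, h2⟩ := isTail_cons_iff.1 h
    rcases eq_or_ne i j with rfl | hij
    · exact Or.inr ⟨t, h2, rfl⟩
    · have : (i : ℕ) ≠ j := fun h => hij (PNat.coe_injective h)
      exact Or.inl (isTail_cons_iff.2 ⟨by omega, h2⟩)

section Fock

variable {H : Type} [NormedAddCommGroup H] [InnerProductSpace ℂ H]

open Classical in
/-- The basis vector indexed by `l`, or `0` if `l` is not strictly increasing. -/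
noncomputable def fockVec (e : HilbertBasis MonIdx ℂ H) (l : List ℕ+) : H :=
  if h : l.IsChain (· < ·) then e ⟨l, h⟩ else 0

theorem fockVec_of_isChain (e : HilbertBasis MonIdx ℂ H) {l : List ℕ+}
    (h : l.IsChain (· < ·)) : fockVec e l = e ⟨l, h⟩ := dif_pos h

theorem fockVec_of_not_isChain (e : HilbertBasis MonIdx ℂ H) {l : List ℕ+}
    (h : ¬ l.IsChain (· < ·)) : fockVec e l = 0 := dif_neg h

theorem fockVec_cons_cons_of_le (e : HilbertBasis MonIdx ℂ H) {i j : ℕ+} (h : j ≤ i)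
    (l : List ℕ+) : fockVec e (i :: j :: l) = 0 :=
  fockVec_of_not_isChain e fun hc => (List.isChain_cons_cons.1 hc).1.not_ge h

theorem inner_fockVec (e : HilbertBasis MonIdx ℂ H) {l m : List ℕ+}
    (hl : l.IsChain (· < ·)) :
    inner ℂ (fockVec e l) (fockVec e m) = if l = m then 1 else 0 := by
  by_cases hm : m.IsChain (· < ·)
  · rw [fockVec_of_isChain e hl, fockVec_of_isChain e hm,
      orthonormal_iff_ite.1 e.orthonormal]
    exact if_congr Subtype.ext_iff rfl rfl
  · rw [fockVec_of_not_isChain e hm, inner_zero_right, if_neg]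
    rintro rfl
    exact hm hl

theorem eq_of_inner_fockVec (e : HilbertBasis MonIdx ℂ H) {x y : H}
    (h : ∀ l : List ℕ+, l.IsChain (· < ·) →
      inner ℂ (fockVec e l) x = inner ℂ (fockVec e l) y) : x = y := by
  apply e.repr.injective
  ext ⟨l, hl⟩
  rw [e.repr_apply_apply, e.repr_apply_apply, ← fockVec_of_isChain e hl]
  exact h l hl

theorem ext_fockVec (e : HilbertBasis MonIdx ℂ H) {A B : H →L[ℂ] H}
    (h : ∀ l : List ℕ+, IsTail 0 l → A (fockVec e l) = B (fockVec e l)) : A = B := by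
  refine ContinuousLinearMap.ext_on
    (Submodule.dense_iff_topologicalClosure_eq_top.2 e.dense_span) ?_
  rintro _ ⟨⟨l, hl⟩, rfl⟩
  rw [← fockVec_of_isChain e hl]
  exact h l ⟨hl, fun x _ => x.pos⟩

section Creation

variable [CompleteSpace H] {e : HilbertBasis MonIdx ℂ H} {A : H →L[ℂ] H} {i : ℕ+}

theorem adjoint_creation_cons
    (hA : ∀ l, A (fockVec e l) = fockVec e (i :: l)) {l : List ℕ+} (hl : IsTail i l) :
    ContinuousLinearMap.adjoint A (fockVec e (i :: l)) = fockVec e l := by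
  have hc : (i :: l).IsChain (· < ·) := (isTail_cons_iff.2 ⟨i.pos, hl⟩).1
  refine eq_of_inner_fockVec e fun m hm => ?_
  rw [ContinuousLinearMap.adjoint_inner_right, hA, ← inner_conj_symm,
    inner_fockVec e hc, inner_fockVec e hm]
  simp [eq_comm]

theorem adjoint_creation_eq_zero
    (hA : ∀ l, A (fockVec e l) = fockVec e (i :: l)) {l : List ℕ+}
    (hl : ∀ t, l ≠ i :: t) :
    ContinuousLinearMap.adjoint A (fockVec e l) = 0 := by
  by_cases hc : l.IsChain (· < ·)
  · refine eq_of_inner_fockVec e fun m _ => ?_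
    rw [ContinuousLinearMap.adjoint_inner_right, hA, ← inner_conj_symm, inner_fockVec e hc,
      if_neg (hl m)]
    simp
  · rw [fockVec_of_not_isChain e hc, map_zero]

theorem adjoint_creation_of_isTail
    (hA : ∀ l, A (fockVec e l) = fockVec e (i :: l)) {n : ℕ} (hi : (i : ℕ) ≤ n)
    {l : List ℕ+} (hl : IsTail n l) :
    ContinuousLinearMap.adjoint A (fockVec e l) = 0 := by
  refine adjoint_creation_eq_zero hA ?_
  rintro t rfl
  exact (isTail_cons_iff.1 hl).1.not_ge hi

theorem adjoint_creation_cons_of_ne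
    (hA : ∀ l, A (fockVec e l) = fockVec e (i :: l)) {j : ℕ+} (hij : i ≠ j) (l : List ℕ+) :
    ContinuousLinearMap.adjoint A (fockVec e (j :: l)) = 0 :=
  adjoint_creation_eq_zero hA fun _ h => hij (List.cons.inj h).1.symm

end Creation

end Fock

/-- On the monotone Fock space, with `s_i = a_i + a_i†`, the operators
`S₂ = s₁ + s₂` and `S₃ = s₁ + s₂ + s₃` satisfy `3S₂² − S₂⁴ = I` and
`7S₃² − 13S₃⁴ + 7S₃⁶ − S₃⁸ = I`. -/
theorem monotone_sum_polynomial_identities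
    (H : Type) [NormedAddCommGroup H] [InnerProductSpace ℂ H] [CompleteSpace H]
    (e : HilbertBasis MonIdx ℂ H)
    (a adag : ℕ+ → H →L[ℂ] H)
    (hadj : ∀ i, a i = ContinuousLinearMap.adjoint (adag i))
    (hcr : ∀ (i : ℕ+) (l : List ℕ+) (hl : l.Chain' (· < ·))
      (h : (i :: l).Chain' (· < ·)), adag i (e ⟨l, hl⟩) = e ⟨i :: l, h⟩)
    (hcr0 : ∀ (i : ℕ+) (l : List ℕ+) (hl : l.Chain' (· < ·)),
      ¬ (i :: l).Chain' (· < ·) → adag i (e ⟨l, hl⟩) = 0) :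
    (3 : ℂ) • ((a 1 + adag 1) + (a 2 + adag 2)) ^ 2
        - ((a 1 + adag 1) + (a 2 + adag 2)) ^ 4 = 1 ∧
      (7 : ℂ) • ((a 1 + adag 1) + (a 2 + adag 2) + (a 3 + adag 3)) ^ 2
        - (13 : ℂ) • ((a 1 + adag 1) + (a 2 + adag 2) + (a 3 + adag 3)) ^ 4
        + (7 : ℂ) • ((a 1 + adag 1) + (a 2 + adag 2) + (a 3 + adag 3)) ^ 6
        - ((a 1 + adag 1) + (a 2 + adag 2) + (a 3 + adag 3)) ^ 8 = 1 := by
  have hA : ∀ i l, adag i (fockVec e l) = fockVec e (i :: l) := by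
    intro i l
    by_cases hl : l.IsChain (· < ·)
    · rw [fockVec_of_isChain e hl]
      by_cases h : (i :: l).IsChain (· < ·)
      · rw [fockVec_of_isChain e h]
        exact hcr i l hl h
      · rw [fockVec_of_not_isChain e h]
        exact hcr0 i l hl h
    · rw [fockVec_of_not_isChain e hl, map_zero,
        fockVec_of_not_isChain e fun h => hl (List.isChain_cons.1 h).2]
  have hne : ∀ (i j : ℕ+) (l : List ℕ+), i ≠ j → a i (fockVec e (j :: l)) = 0 := by
    intro i j l hij
    rw [hadj]
    exact adjoint_creation_cons_of_ne (hA i) hij l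
  have hself : ∀ (i : ℕ+) (l : List ℕ+), IsTail i l →
      a i (fockVec e (i :: l)) = fockVec e l := by
    intro i l hl
    rw [hadj]
    exact adjoint_creation_cons (hA i) hl
  have htail : ∀ (n i : ℕ+) (l : List ℕ+), i ≤ n → IsTail n l → a i (fockVec e l) = 0 := by
    intro n i l hi hl
    rw [hadj]
    exact adjoint_creation_of_isTail (hA i) hi hl
  have h21 := fun l => fockVec_cons_cons_of_le e (show (1 : ℕ+) ≤ 2 by decide) l
  have h31 := fun l => fockVec_cons_cons_of_le e (show (1 : ℕ+) ≤ 3 by decide) l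
  have h32 := fun l => fockVec_cons_cons_of_le e (show (2 : ℕ+) ≤ 3 by decide) l
  have hrefl := fun (i : ℕ+) l => fockVec_cons_cons_of_le e (le_refl i) l
  have n12 := fun l => hne 1 2 l (by decide)
  have n13 := fun l => hne 1 3 l (by decide)
  have n21 := fun l => hne 2 1 l (by decide)
  have n23 := fun l => hne 2 3 l (by decide)
  have n31 := fun l => hne 3 1 l (by decide)
  have n32 := fun l => hne 3 2 l (by decide)
  constructor
  · set S := (a 1 + adag 1) + (a 2 + adag 2) with hS
    refine ext_fockVec e fun l hl => ?_
    obtain ⟨t, ht, hlt⟩ : ∃ t, IsTail 2 t ∧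
        (l = t ∨ l = 1 :: t ∨ l = 2 :: t ∨ l = 1 :: 2 :: t) := by
      rcases hl.succ_or_cons 1 rfl with h1 | ⟨l, h1, rfl⟩ <;>
      rcases h1.succ_or_cons 2 rfl with h2 | ⟨t, h2, rfl⟩ <;>
      exact ⟨_, by assumption, by simp⟩
    have ht1 : IsTail 1 t := ht.mono (by decide)
    have ht12 : IsTail 1 (2 :: t) := isTail_cons_iff.2 ⟨by decide, ht⟩
    have s0 : S (fockVec e t) = fockVec e (1 :: t) + fockVec e (2 :: t) := by
      simp [hS, hA, htail 2 1 t (by decide) ht, htail 2 2 t (by decide) ht]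
    have s1 : S (fockVec e (1 :: t)) = fockVec e t := by
      simp [hS, hA, hself 1 t ht1, n21, h21, hrefl]
    have s2 : S (fockVec e (2 :: t)) = fockVec e t + fockVec e (1 :: 2 :: t) := by
      simp [hS, hA, hself 2 t ht, n12, hrefl, add_comm]
    have s12 : S (fockVec e (1 :: 2 :: t)) = fockVec e (2 :: t) := by
      simp [hS, hA, hself 1 _ ht12, n21, h21, hrefl]
    clear_value S
    rcases hlt with rfl | rfl | rfl | rfl <;>
    · simp only [sub_apply, smul_apply, pow_succ, pow_zero,
        one_mul, mul_apply_eq_comp, map_add, s0, s1, s2, s12,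
        one_apply_eq_self]
      module
  · set S := (a 1 + adag 1) + (a 2 + adag 2) + (a 3 + adag 3) with hS
    refine ext_fockVec e fun l hl => ?_
    obtain ⟨t, ht, hlt⟩ : ∃ t, IsTail 3 t ∧
        (l = t ∨ l = 1 :: t ∨ l = 2 :: t ∨ l = 3 :: t ∨ l = 1 :: 2 :: t ∨ l = 1 :: 3 :: t ∨
          l = 2 :: 3 :: t ∨ l = 1 :: 2 :: 3 :: t) := by
      rcases hl.succ_or_cons 1 rfl with h1 | ⟨l, h1, rfl⟩ <;>
      rcases h1.succ_or_cons 2 rfl with h2 | ⟨l, h2, rfl⟩ <;>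
      rcases h2.succ_or_cons 3 rfl with h3 | ⟨t, h3, rfl⟩ <;>
      exact ⟨_, by assumption, by simp⟩
    have ht1 : IsTail 1 t := ht.mono (by decide)
    have ht2 : IsTail 2 t := ht.mono (by decide)
    have ht12 : IsTail 1 (2 :: t) := isTail_cons_iff.2 ⟨by decide, ht2⟩
    have ht23 : IsTail 2 (3 :: t) := isTail_cons_iff.2 ⟨by decide, ht⟩
    have ht13 : IsTail 1 (3 :: t) := ht23.mono (by decide)
    have ht123 : IsTail 1 (2 :: 3 :: t) := isTail_cons_iff.2 ⟨by decide, ht23⟩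
    have s0 : S (fockVec e t) =
        fockVec e (1 :: t) + fockVec e (2 :: t) + fockVec e (3 :: t) := by
      simp [hS, hA, htail 3 1 t (by decide) ht, htail 3 2 t (by decide) ht,
        htail 3 3 t (by decide) ht]
    have s1 : S (fockVec e (1 :: t)) = fockVec e t := by
      simp [hS, hA, hself 1 t ht1, n21, n31, h21, h31, hrefl]
    have s2 : S (fockVec e (2 :: t)) = fockVec e (1 :: 2 :: t) + fockVec e t := by
      simp [hS, hA, hself 2 t ht2, n12, n32, h32, hrefl]
    have s3 : S (fockVec e (3 :: t)) =
        fockVec e (1 :: 3 :: t) + fockVec e (2 :: 3 :: t) + fockVec e t := by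
      simp [hS, hA, hself 3 t ht, n13, n23, hrefl]
    have s12 : S (fockVec e (1 :: 2 :: t)) = fockVec e (2 :: t) := by
      simp [hS, hA, hself 1 _ ht12, n21, n31, h21, h31, hrefl]
    have s13 : S (fockVec e (1 :: 3 :: t)) = fockVec e (3 :: t) := by
      simp [hS, hA, hself 1 _ ht13, n21, n31, h21, h31, hrefl]
    have s23 : S (fockVec e (2 :: 3 :: t)) = fockVec e (1 :: 2 :: 3 :: t) + fockVec e (3 :: t) := by
      simp [hS, hA, hself 2 _ ht23, n12, n32, h32, hrefl]
    have s123 : S (fockVec e (1 :: 2 :: 3 :: t)) = fockVec e (2 :: 3 :: t) := by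
      simp [hS, hA, hself 1 _ ht123, n21, n31, h21, h31, hrefl]
    clear_value S
    rcases hlt with rfl | rfl | rfl | rfl | rfl | rfl | rfl | rfl <;>
    · simp only [sub_apply, add_apply,
        smul_apply, pow_succ, pow_zero, one_mul,
        mul_apply_eq_comp, map_add, s0, s1, s2, s3, s12, s13, s23, s123,
        one_apply_eq_self]
      module
end

section
/- For every positive integer k and every integer j ≥ 0, the position operator s_k commutes with the right position operator r_{k+j}, i.e. [s_k, r_{k+j}] = 0. -/
open Classical in
/-- The basis vector of a finite sequence, extended by zero to sequences which are not strictly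
increasing. -/
noncomputable def monVec {H : Type} [NormedAddCommGroup H] [InnerProductSpace ℂ H]
    (e : HilbertBasis MonIdx ℂ H) (l : List ℕ+) : H :=
  if h : l.Pairwise (· < ·) then e ⟨l, List.isChain_iff_pairwise.2 h⟩ else 0

section monVec

variable {H : Type} [NormedAddCommGroup H] [InnerProductSpace ℂ H] (e : HilbertBasis MonIdx ℂ H)

theorem monVec_coe (i : MonIdx) : monVec e i.1 = e i :=
  dif_pos (List.isChain_iff_pairwise.1 i.2)

theorem monVec_eq_zero {l : List ℕ+} (h : ¬ l.Pairwise (· < ·)) : monVec e l = 0 :=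
  dif_neg h

open Classical in
theorem inner_monVec (l l' : List ℕ+) :
    inner ℂ (monVec e l) (monVec e l') = if l = l' ∧ l.Pairwise (· < ·) then 1 else 0 := by
  by_cases h : l.Pairwise (· < ·)
  · by_cases h' : l'.Pairwise (· < ·)
    · rw [monVec, monVec, dif_pos h, dif_pos h', orthonormal_iff_ite.1 e.orthonormal]
      exact if_congr (Subtype.mk_eq_mk.trans (and_iff_left h).symm) rfl rfl
    · rw [monVec_eq_zero e h', inner_zero_right, if_neg]
      rintro ⟨rfl, -⟩
      exact h' h
  · simp [monVec_eq_zero e h, h]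

theorem ext_inner_monVec {x y : H}
    (h : ∀ l, inner ℂ (monVec e l) x = inner ℂ (monVec e l) y) : x = y := by
  apply e.repr.injective
  ext i
  simpa only [HilbertBasis.repr_apply_apply, monVec_coe] using h i.1

theorem ContinuousLinearMap.ext_monVec {S T : H →L[ℂ] H}
    (h : ∀ l, S (monVec e l) = T (monVec e l)) : S = T := by
  refine ContinuousLinearMap.ext_on (s := Set.range e) ?_ ?_
  · rw [dense_iff_closure_eq, ← Submodule.topologicalClosure_coe, e.dense_span,
      Submodule.top_coe]
  · rintro _ ⟨i, rfl⟩
    simpa only [monVec_coe] using h i.1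

open Classical in
theorem adjoint_apply_monVec [CompleteSpace H] {T : H →L[ℂ] H} {f : List ℕ+ → List ℕ+}
    (hf : f.Injective) (hT : ∀ l, T (monVec e l) = monVec e (f l)) (l : List ℕ+)
    (hl : (f l).Pairwise (· < ·) → l.Pairwise (· < ·)) :
    ContinuousLinearMap.adjoint T (monVec e (f l)) =
      if (f l).Pairwise (· < ·) then monVec e l else 0 := by
  refine ext_inner_monVec e fun l' => ?_
  rw [ContinuousLinearMap.adjoint_inner_right, hT, inner_monVec, apply_ite (inner ℂ (monVec e l')),
    inner_monVec, inner_zero_right]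
  simp only [hf.eq_iff]
  grind

theorem adjoint_apply_monVec_eq_zero [CompleteSpace H] {T : H →L[ℂ] H} {f : List ℕ+ → List ℕ+}
    (hT : ∀ l, T (monVec e l) = monVec e (f l)) {l : List ℕ+} (hl : ∀ l', f l' ≠ l) :
    ContinuousLinearMap.adjoint T (monVec e l) = 0 := by
  refine ext_inner_monVec e fun l' => ?_
  rw [ContinuousLinearMap.adjoint_inner_right, hT, inner_monVec, inner_zero_right]
  simp [hl l']

end monVec

/-- On the monotone Fock space, for every positive integer `k` and every
integer `j ≥ 0` (equivalently, for every `m ≥ k`), the position operator `s_k = a_k + a_k†`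
commutes with the right position operator `r_m = b_m + b_m†`: `[s_k, r_{k+j}] = 0`. -/
theorem monotone_position_commutes_right_position
    (H : Type) [NormedAddCommGroup H] [InnerProductSpace ℂ H] [CompleteSpace H]
    (e : HilbertBasis MonIdx ℂ H)
    (a adag b bdag : ℕ+ → H →L[ℂ] H)
    (hadj : ∀ i, a i = ContinuousLinearMap.adjoint (adag i))
    (hcr : ∀ (i : ℕ+) (l : List ℕ+) (hl : l.Chain' (· < ·))
      (h : (i :: l).Chain' (· < ·)), adag i (e ⟨l, hl⟩) = e ⟨i :: l, h⟩)
    (hcr0 : ∀ (i : ℕ+) (l : List ℕ+) (hl : l.Chain' (· < ·)),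
      ¬ (i :: l).Chain' (· < ·) → adag i (e ⟨l, hl⟩) = 0)
    (hradj : ∀ i, b i = ContinuousLinearMap.adjoint (bdag i))
    (hrcr : ∀ (i : ℕ+) (l : List ℕ+) (hl : l.Chain' (· < ·))
      (h : (l ++ [i]).Chain' (· < ·)), bdag i (e ⟨l, hl⟩) = e ⟨l ++ [i], h⟩)
    (hrcr0 : ∀ (i : ℕ+) (l : List ℕ+) (hl : l.Chain' (· < ·)),
      ¬ (l ++ [i]).Chain' (· < ·) → bdag i (e ⟨l, hl⟩) = 0) :
    ∀ k m : ℕ+, k ≤ m →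
      (a k + adag k) * (b m + bdag m) = (b m + bdag m) * (a k + adag k) := by
  classical
  intro k m hkm
  have hA (i : ℕ+) (l : List ℕ+) : adag i (monVec e l) = monVec e (i :: l) := by
    by_cases h : l.Pairwise (· < ·)
    · rw [monVec, dif_pos h, monVec]
      split_ifs with h'
      · exact hcr _ _ _ _
      · exact hcr0 _ _ _ (mt List.isChain_iff_pairwise.1 h')
    · rw [monVec_eq_zero e h, map_zero, monVec_eq_zero e (mt List.Pairwise.of_cons h)]
  have hB (i : ℕ+) (l : List ℕ+) : bdag i (monVec e l) = monVec e (l ++ [i]) := by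
    by_cases h : l.Pairwise (· < ·)
    · rw [monVec, dif_pos h, monVec]
      split_ifs with h'
      · exact hrcr _ _ _ _
      · exact hrcr0 _ _ _ (mt List.isChain_iff_pairwise.1 h')
    · rw [monVec_eq_zero e h, map_zero,
        monVec_eq_zero e (mt (fun h' => (List.pairwise_append.1 h').1) h)]
  have ha_nil : a k (monVec e []) = 0 := by
    rw [hadj]
    exact adjoint_apply_monVec_eq_zero e (hA k) (by simp)
  have ha_cons (x : ℕ+) (l : List ℕ+) : a k (monVec e (x :: l)) =
      if x = k ∧ (x :: l).Pairwise (· < ·) then monVec e l else 0 := by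
    rw [hadj]
    by_cases hx : x = k
    · subst hx
      simpa only [true_and] using
        adjoint_apply_monVec e List.cons_injective (hA x) l List.Pairwise.of_cons
    · rw [if_neg fun h => hx h.1]
      exact adjoint_apply_monVec_eq_zero e (hA k) (by grind)
  have hb_nil : b m (monVec e []) = 0 := by
    rw [hradj]
    exact adjoint_apply_monVec_eq_zero e (hB m) (by simp)
  have hb_append (x : ℕ+) (l : List ℕ+) : b m (monVec e (l ++ [x])) =
      if x = m ∧ (l ++ [x]).Pairwise (· < ·) then monVec e l else 0 := by
    rw [hradj]
    by_cases hx : x = m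
    · subst hx
      simpa only [true_and] using
        adjoint_apply_monVec e (List.append_left_injective [x]) (hB x) l
          fun h => (List.pairwise_append.1 h).1
    · rw [if_neg fun h => hx h.1]
      exact adjoint_apply_monVec_eq_zero e (hB m)
        fun l' h => hx (by simpa using (List.append_inj_right' h rfl).symm)
  have hcomm : adag k * bdag m = bdag m * adag k :=
    ContinuousLinearMap.ext_monVec e fun l => by
      simp only [mul_apply_eq_comp, hA, hB, List.cons_append]
  have hcomm' : a k * b m = b m * a k := by
    have := congrArg ContinuousLinearMap.adjoint hcomm
    simp only [ContinuousLinearMap.mul_def, ContinuousLinearMap.adjoint_comp] at this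
    rw [hadj, hradj]
    exact this.symm
  have hmixed : adag k * b m + a k * bdag m = b m * adag k + bdag m * a k := by
    refine ContinuousLinearMap.ext_monVec e fun l => ?_
    simp only [add_apply, mul_apply_eq_comp]
    rcases l with _ | ⟨x, l⟩
    · have hb := hb_append k []
      rw [List.nil_append] at hb
      simp only [hA, hB, ha_nil, hb_nil, map_zero, List.nil_append, ha_cons, hb]
      simp [eq_comm]
    · rcases List.eq_nil_or_concat l with rfl | ⟨l, y, rfl⟩
      · have hb := hb_append x []
        have hb' := hb_append x [k]
        simp only [List.nil_append, List.cons_append] at hb hb'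
        simp only [hA, hB, ha_cons, hb, hb', List.cons_append, List.nil_append,
          apply_ite (adag k), apply_ite (bdag m), map_zero]
        have hk : ¬ k < x → monVec e [k, x] = 0 := fun h => monVec_eq_zero e (by simpa using h)
        simp only [List.pairwise_cons, List.Pairwise.nil, List.mem_singleton, forall_eq,
          List.not_mem_nil, false_imp_iff, implies_true, and_true]
        rcases hkm.eq_or_lt with rfl | hlt <;> grind
      · have hb := hb_append y (x :: l)
        have hb' := hb_append y (k :: x :: l)
        simp only [List.cons_append] at hb hb'
        simp only [List.concat_eq_append, hA, hB, ha_cons, hb, hb', List.cons_append,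
          apply_ite (adag k), apply_ite (bdag m), map_zero]
        congr 1
        · have h0 := monVec_eq_zero e (l := k :: x :: l)
          split_ifs <;> grind
        · have h0 := monVec_eq_zero e (l := l ++ [y] ++ [m])
          split_ifs <;> grind
  calc (a k + adag k) * (b m + bdag m)
      = a k * b m + adag k * bdag m + (adag k * b m + a k * bdag m) := by noncomm_ring
    _ = b m * a k + bdag m * adag k + (b m * adag k + bdag m * a k) := by
      rw [hcomm, hcomm', hmixed]
    _ = (b m + bdag m) * (a k + adag k) := by noncomm_ring
end
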